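/- Let A be a commutative noetherian ring with 1, S a finite set, and {f_s}_{s∈S} an A-sequence. An S-cube x in the category of finitely generated projective A-modules is a Koszul cube associated with {f_s}_{s∈S} if and only if x is admissible and, for every T ⊆ S and every U ⊆ S∖T, the vertex H_0^T(x)_U of the iterated cokernel cube is a finitely generated A-module of projective dimension ≤ #T whose support is contained in V(f_T), where f_T is the ideal generated by {f_t}_{t∈T}. -/

import Mathlib

open CategoryTheory CategoryTheory.Limits Opposite

attribute [local instance] CategoryTheory.Abelian.hasFiniteBiproducts

set_option linter.unusedSectionVars false

universe w v u

/-- An `ι`-cube in a category `𝒜`: a contravariant functor from the poset of finite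
subsets of `ι` (ordered by inclusion) to `𝒜`.  An `S`-cube (for `S : Finset ι`) is such a
functor, of which only the values on subsets of `S` are relevant. -/
abbrev Cube (𝒜 : Type u) [Category.{v} 𝒜] (ι : Type w) := (Finset ι)ᵒᵖ ⥤ 𝒜

namespace Cube

variable {𝒜 : Type u} [Category.{v} 𝒜] {ι : Type w} [DecidableEq ι]

/-- The vertex `x_T` of a cube `x` at a finite subset `T`. -/
def vtx (x : Cube 𝒜 ι) (T : Finset ι) : 𝒜 := x.obj (op T)

/-- The structure morphism `x_T ⟶ x_U` of a cube for `U ⊆ T`. -/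
def mapLE (x : Cube 𝒜 ι) {T U : Finset ι} (h : U ⊆ T) : x.vtx T ⟶ x.vtx U :=
  x.map (homOfLE h).op

lemma mapLE_refl (x : Cube 𝒜 ι) (T : Finset ι) (h : T ⊆ T) : x.mapLE h = 𝟙 (x.vtx T) := by
  show x.map (homOfLE h).op = _
  rw [show (homOfLE h).op = 𝟙 (op T) from rfl, x.map_id]; rfl

lemma mapLE_comp (x : Cube 𝒜 ι) {T U V : Finset ι} (h1 : U ⊆ T) (h2 : V ⊆ U) :
    x.mapLE h1 ≫ x.mapLE h2 = x.mapLE (h2.trans h1) := by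
  show x.map _ ≫ x.map _ = x.map _
  rw [← x.map_comp]
  rfl

/-- The `k`-direction boundary morphism `d^k_T : x_T ⟶ x_{T ∖ {k}}` of a cube. -/
def bd (x : Cube 𝒜 ι) (T : Finset ι) (k : ι) : x.vtx T ⟶ x.vtx (T.erase k) :=
  x.mapLE (Finset.erase_subset k T)

/-- The `k`-direction `0`-th homology `H⁰ₖ(x)` of a cube in an abelian category, an
`(S ∖ {k})`-cube: its vertex at `T` is the cokernel of the boundary morphism
`d^k_{T ∪ {k}} : x_{T ∪ {k}} ⟶ x_{(T ∪ {k}) ∖ {k}}`. -/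
noncomputable def H0 [Abelian 𝒜] (x : Cube 𝒜 ι) (k : ι) : Cube 𝒜 ι where
  obj T := cokernel (x.bd (insert k T.unop) k)
  map {T U} f :=
    cokernel.map _ _
      (x.mapLE (Finset.insert_subset_insert k (leOfHom f.unop)))
      (x.mapLE (Finset.erase_subset_erase k (Finset.insert_subset_insert k (leOfHom f.unop))))
      (by rw [bd, bd, mapLE_comp, mapLE_comp])
  map_id T := by
    apply coequalizer.hom_ext
    simp [cokernel.map]
    rw [mapLE_refl]
    simp
  map_comp {T U V} f g := by
    apply coequalizer.hom_ext
    simp [cokernel.map]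
    rw [← Category.assoc, mapLE_comp]

/-- Admissibility of an `S`-cube `x` in an abelian category, by recursion on `#S`:
`x` is admissible if all its boundary morphisms `d^k_T` (`k ∈ T ⊆ S`) are monomorphisms and
for every `k ∈ S` the `(S ∖ {k})`-cube `H⁰ₖ(x)` is admissible.  (For `S = ∅` the conditions
are vacuous, and for `#S = 1` this says exactly that the boundary morphism of `x` is a
monomorphism.) -/
def Admissible [Abelian 𝒜] (x : Cube 𝒜 ι) (S : Finset ι) : Prop :=
  (∀ T ⊆ S, ∀ k ∈ T, Mono (x.bd T k)) ∧
  ∀ k, (hk : k ∈ S) → Admissible (x.H0 k) (S.erase k)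
termination_by S.card
decreasing_by exact Finset.card_erase_lt_of_mem hk

/-- Iterated `0`-th homology:
`H0s x [i₁, …, i_r] = H⁰_{i₁}(H⁰_{i₂}(⋯(H⁰_{i_r}(x))⋯))`. -/
noncomputable def H0s [Abelian 𝒜] (x : Cube 𝒜 ι) : List ι → Cube 𝒜 ι
  | [] => x
  | k :: ks => (x.H0s ks).H0 k

end Cube

/-- A list `f₁, …, f_q` of elements of a commutative ring is an *regular sequence* if no
`fᵢ` is a unit and, for each `i`, `f_{i+1}` is a non-zero-divisor on `R/(f₁, …, fᵢ)`
(the case `i = 0` saying that `f₁` is a non-zero-divisor on `R`). -/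
def IsRegularSeq {R : Type*} [CommRing R] (fs : List R) : Prop :=
  (∀ f ∈ fs, ¬ IsUnit f) ∧
  ∀ i : Fin fs.length, ∀ x : R,
    fs.get i * x ∈ Ideal.span {y | y ∈ fs.take i.1} →
    x ∈ Ideal.span {y | y ∈ fs.take i.1}

/-- The family `{f s}_{s ∈ S}` is an *`A`-sequence*: every enumeration of `S` yields an
`A`-regular sequence. -/
def IsFamilyASeq {A : Type u} [CommRing A] {ι : Type w} [DecidableEq ι]
    (S : Finset ι) (f : ι → A) : Prop :=
  ∀ l : List ι, l.Nodup → l.toFinset = S → IsRegularSeq (l.map f)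

/-- `pdLE A n M` : the `A`-module `M` has projective dimension at most `n`. -/
def pdLE (A : Type u) [CommRing A] : ℕ → (M : Type v) → [AddCommGroup M] → [Module A M] → Prop
  | 0, M, _, _ => Module.Projective A M
  | n+1, M, _, _ => ∃ (P : Type v) (_ : AddCommGroup P) (_ : Module A P) (g : P →ₗ[A] M),
      Module.Projective A P ∧ Function.Surjective g ∧ pdLE A n (LinearMap.ker g)

/-- A *Koszul cube* associated with the family `{f s}_{s ∈ S}` : an `S`-cube of finitely
generated projective `A`-modules such that every boundary morphism `d^k_T` (`k ∈ T ⊆ S`) is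
injective and its cokernel is of projective dimension at most `1` and annihilated by some
power of `f k` (i.e. supported on `V(f k · A)`). -/
def IsKoszulCube {A : Type u} [CommRing A] {ι : Type w} [DecidableEq ι]
    (x : Cube (ModuleCat.{u} A) ι) (S : Finset ι) (f : ι → A) : Prop :=
  (∀ T ⊆ S, Module.Finite A (x.vtx T) ∧ Module.Projective A (x.vtx T)) ∧
  (∀ T ⊆ S, ∀ k ∈ T, Function.Injective (x.bd T k) ∧
    pdLE A 1 ((x.vtx (T.erase k)) ⧸ LinearMap.range (x.bd T k).hom) ∧
    ∃ n : ℕ, ∀ m : (x.vtx (T.erase k)) ⧸ LinearMap.range (x.bd T k).hom, (f k) ^ n • m = 0)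


namespace KoszulAux

open RingTheory.Sequence
open scoped Pointwise

section Alg

variable {A : Type u} [CommRing A]

lemma mono_iff_inj {M N : ModuleCat.{u} A} (g : M ⟶ N) : Mono g ↔ Function.Injective g.hom :=
  ModuleCat.mono_iff_injective g

lemma shortExact_of {M' M N : Type u} [AddCommGroup M'] [Module A M'] [AddCommGroup M] [Module A M]
    [AddCommGroup N] [Module A N] (φ : M' →ₗ[A] M) (ψ : M →ₗ[A] N)
    (hφ : Function.Injective φ) (hex : Function.Exact φ ψ) (hψ : Function.Surjective ψ) :
    (ShortComplex.mk (ModuleCat.ofHom φ) (ModuleCat.ofHom ψ)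
      (by ext m; exact hex.apply_apply_eq_zero m)).ShortExact where
  exact := by
    rw [ShortComplex.ShortExact.moduleCat_exact_iff_function_exact]
    exact hex
  mono_f := (ModuleCat.mono_iff_injective _).2 hφ
  epi_g := (ModuleCat.epi_iff_surjective _).2 hψ

lemma pdLE_iff (n : ℕ) (M : Type u) [AddCommGroup M] [Module A M] :
    pdLE A n M ↔ HasProjectiveDimensionLT (ModuleCat.of A M) (n + 1) := by
  induction n generalizing M with
  | zero =>
    rw [zero_add, ← projective_iff_hasProjectiveDimensionLT_one]
    exact IsProjective.iff_projective M
  | succ n ih =>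
    constructor
    · rintro ⟨P, _, _, g, hP, hg, hk⟩
      have h := shortExact_of (LinearMap.ker g).subtype g (Submodule.injective_subtype _)
        (LinearMap.exact_subtype_ker_map g) hg
      refine (h.hasProjectiveDimensionLT_X₃_iff n ((IsProjective.iff_projective P).1 hP)).2 ?_
      exact (ih _).1 hk
    · intro hM
      obtain ⟨P, _, _, g, hP, hg⟩ : ∃ (P : Type u) (_ : AddCommGroup P) (_ : Module A P)
          (g : P →ₗ[A] M), Module.Projective A P ∧ Function.Surjective g :=
        ⟨M →₀ A, inferInstance, inferInstance, Finsupp.linearCombination A id, inferInstance,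
          Finsupp.linearCombination_id_surjective A M⟩
      have h := shortExact_of (LinearMap.ker g).subtype g (Submodule.injective_subtype _)
        (LinearMap.exact_subtype_ker_map g) hg
      refine ⟨P, _, _, g, hP, hg, (ih _).2 ?_⟩
      exact (h.hasProjectiveDimensionLT_X₃_iff n ((IsProjective.iff_projective P).1 hP)).1 hM

lemma pdLE_of_exact {n : ℕ} {M' M N : Type u} [AddCommGroup M'] [Module A M']
    [AddCommGroup M] [Module A M]
    [AddCommGroup N] [Module A N] (φ : M' →ₗ[A] M) (ψ : M →ₗ[A] N)
    (hφ : Function.Injective φ) (hex : Function.Exact φ ψ) (hψ : Function.Surjective ψ)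
    (h1 : pdLE A n M') (h2 : pdLE A n M) : pdLE A (n + 1) N := by
  rw [pdLE_iff] at *
  refine (shortExact_of φ ψ hφ hex hψ).hasProjectiveDimensionLT_X₃ (n + 1) h1 ?_
  exact hasProjectiveDimensionLT_of_ge _ (n + 1) _ (by omega)

/-- Regularity of one element on the cokernel. -/
lemma isSMulRegular_coker {M' M N : Type u} [AddCommGroup M'] [Module A M']
    [AddCommGroup M] [Module A M]
    [AddCommGroup N] [Module A N] (φ : M' →ₗ[A] M) (ψ : M →ₗ[A] N)
    (hφ : Function.Injective φ) (hex : Function.Exact φ ψ) (hψ : Function.Surjective ψ)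
    (f g : A) (n : ℕ) (hn : ∀ m : N, f ^ n • m = 0)
    (h1 : IsWeaklyRegular M' [g, f]) (h2 : IsSMulRegular M g) : IsSMulRegular N g := by
  rw [isWeaklyRegular_cons_iff, isWeaklyRegular_singleton_iff] at h1
  refine IsSMulRegular.of_right_eq_zero_of_smul fun z hz => ?_
  obtain ⟨m, rfl⟩ := hψ z
  rw [← map_smul] at hz
  obtain ⟨m', hm'⟩ := (hex _).1 hz
  obtain ⟨c, hc⟩ := (hex (f ^ n • m)).1 (by rw [map_smul, hn])
  have e1 : f ^ n • m' = g • c := by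
    apply hφ
    rw [map_smul, map_smul, hm', hc, smul_comm]
  have hpow : IsSMulRegular (QuotSMulTop g M') (f ^ n) := h1.2.pow n
  have : m' ∈ (g • ⊤ : Submodule A M') := by
    refine mem_of_isSMulRegular_quotient_of_smul_mem hpow ?_
    rw [e1]
    exact Submodule.smul_mem_pointwise_smul c g ⊤ trivial
  obtain ⟨d, -, rfl⟩ := (Submodule.mem_smul_pointwise_iff_exists _ _ _).1 this
  refine (hex _).2 ⟨d, h2 ?_⟩
  simp only [← map_smul]
  exact hm'

lemma isWeaklyRegular_coker (f : A) (n : ℕ) (gs : List A) :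
    ∀ {M' M N : Type u} [AddCommGroup M'] [Module A M']
    [AddCommGroup M] [Module A M]
    [AddCommGroup N] [Module A N] (φ : M' →ₗ[A] M) (ψ : M →ₗ[A] N)
    (_ : Function.Injective φ) (_ : Function.Exact φ ψ) (_ : Function.Surjective ψ)
    (_ : ∀ m : N, f ^ n • m = 0)
    (_ : ∀ gs', gs' <+: gs → IsWeaklyRegular M' (gs' ++ [f])) (_ : IsWeaklyRegular M gs),
    IsWeaklyRegular N gs := by
  induction gs with
  | nil => intros; exact IsWeaklyRegular.nil _ _
  | cons g gs ih =>
    intro M' M N _ _ _ _ _ _ φ ψ hφ hex hψ hn h1 h2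
    rw [isWeaklyRegular_cons_iff] at h2
    have hg : IsSMulRegular N g := isSMulRegular_coker φ ψ hφ hex hψ f g n hn
      (h1 [g] (by simp)) h2.1
    rw [isWeaklyRegular_cons_iff]
    refine ⟨hg, ih (QuotSMulTop.map g φ) (QuotSMulTop.map g ψ) ?_
      (QuotSMulTop.map_exact g hex hψ) (QuotSMulTop.map_surjective g hψ) ?_ ?_ h2.2⟩
    · have h0 : Function.Exact (0 : PUnit.{u+1} →ₗ[A] M') φ := by
        intro y
        simp only [LinearMap.zero_apply, Set.mem_range, exists_const]
        rw [map_eq_zero_iff φ hφ, eq_comm]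
      have := QuotSMulTop.map_first_exact_on_four_term_exact_of_isSMulRegular_last h0 hex hg
      rw [injective_iff_map_eq_zero]
      intro a ha
      obtain ⟨b, rfl⟩ := (this a).1 ha
      obtain ⟨b, rfl⟩ := Submodule.Quotient.mk_surjective _ b
      rw [QuotSMulTop.map_apply_mk]
      rfl
    · intro m
      obtain ⟨b, rfl⟩ := Submodule.Quotient.mk_surjective _ m
      rw [← Submodule.Quotient.mk_smul, hn]
      rfl
    · intro gs' hgs'
      have := h1 (g :: gs') (by simpa using hgs')
      rw [List.cons_append, isWeaklyRegular_cons_iff] at this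
      exact this.2

lemma isWeaklyRegular_of_isRegularSeq {fs gs : List A} (h : IsRegularSeq (fs ++ gs)) :
    IsWeaklyRegular A fs := by
  have : IsWeaklyRegular A (fs ++ gs) := by
    rw [isWeaklyRegular_iff_Fin]
    intro i
    rw [isSMulRegular_quotient_iff_mem_of_smul_mem]
    intro a ha
    have := h.2 i a
    simp only [smul_eq_mul, Ideal.mul_top] at ha ⊢
    exact this ha
  exact ((isWeaklyRegular_append_iff _ _ _).1 this).1

lemma isWeaklyRegular_of_flat {fs : List A} (h : IsWeaklyRegular A fs) (M : Type u)
    [AddCommGroup M] [Module A M] [Module.Flat A M] : IsWeaklyRegular M fs :=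
  ((TensorProduct.rid A M).isWeaklyRegular_congr fs).1 h.isWeaklyRegular_lTensor

lemma isWeaklyRegular_of_family {ι : Type w} [DecidableEq ι] {S : Finset ι} {f : ι → A}
    (hf : IsFamilyASeq S f) (l : List ι) (hl : l.Nodup) (hlS : l.toFinset ⊆ S) :
    IsWeaklyRegular A (l.map f) := by
  refine isWeaklyRegular_of_isRegularSeq (gs := (S \ l.toFinset).toList.map f) ?_
  rw [← List.map_append]
  apply hf
  · rw [List.nodup_append']
    refine ⟨hl, Finset.nodup_toList _, ?_⟩
    intro a ha hb
    simp at hb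
    exact hb.2 ha
  · rw [List.toFinset_append, Finset.toList_toFinset]
    exact Finset.union_sdiff_of_subset hlS

end Alg


section CubeAux

variable {A : Type u} [CommRing A] {ι : Type w} [DecidableEq ι]

/-- The projection onto a vertex of `H0`. -/
noncomputable def pr (y : Cube (ModuleCat.{u} A) ι) (k : ι) (T : Finset ι) :
    y.vtx ((insert k T).erase k) ⟶ (y.H0 k).vtx T :=
  cokernel.π (y.bd (insert k T) k)

lemma pr_surjective (y : Cube (ModuleCat.{u} A) ι) (k : ι) (T : Finset ι) :
    Function.Surjective (pr y k T).hom := by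
  have : Epi (pr y k T) := inferInstanceAs (Epi (cokernel.π (y.bd (insert k T) k)))
  exact (ModuleCat.epi_iff_surjective _).1 this

lemma pr_exact (y : Cube (ModuleCat.{u} A) ι) (k : ι) (T : Finset ι) :
    Function.Exact (y.mapLE (Finset.erase_subset k (insert k T))).hom (pr y k T).hom := by
  have := ShortComplex.exact_cokernel (y.bd (insert k T) k)
  rw [ShortComplex.ShortExact.moduleCat_exact_iff_function_exact] at this
  exact this

lemma pr_nat (y : Cube (ModuleCat.{u} A) ι) (k : ι) {T U : Finset ι} (h : U ⊆ T)
    (h' : (insert k U).erase k ⊆ (insert k T).erase k)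
    (m : y.vtx ((insert k T).erase k)) :
    ((y.H0 k).mapLE h).hom ((pr y k T).hom m) = (pr y k U).hom ((y.mapLE h').hom m) := by
  have : pr y k T ≫ (y.H0 k).mapLE h = y.mapLE h' ≫ pr y k U :=
    cokernel.π_desc _ _ _
  exact congrArg (fun q => q.hom m) this

lemma mapLE_mapLE (y : Cube (ModuleCat.{u} A) ι) {T U V : Finset ι} (h1 : U ⊆ T) (h2 : V ⊆ U)
    (h3 : V ⊆ T) (m : y.vtx T) :
    (y.mapLE h2).hom ((y.mapLE h1).hom m) = (y.mapLE h3).hom m :=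
  congrArg (fun q => q.hom m) (y.mapLE_comp h1 h2)

/-- The inductive invariant. -/
structure Good (f : ι → A) (y : Cube (ModuleCat.{u} A) ι) (W : Finset ι) : Prop where
  inj : ∀ (U V : Finset ι) (h : V ⊆ U), U ⊆ W → ∀ k ∈ U, V = U.erase k →
    Function.Injective (y.mapLE h).hom
  nil : ∀ (U V : Finset ι) (h : V ⊆ U), U ⊆ W → ∀ k ∈ U, V = U.erase k →
    ∃ n : ℕ, ∀ m : y.vtx V, ∃ c, (y.mapLE h).hom c = f k ^ n • m
  reg : ∀ U ⊆ W, ∀ l : List ι, l.Nodup → l.toFinset ⊆ W →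
    IsWeaklyRegular (y.vtx U) (l.map f)

lemma Good.killed {f : ι → A} {y : Cube (ModuleCat.{u} A) ι} {W : Finset ι}
    (hy : Good f y W) {j : ι} {U : Finset ι} (hU : insert j U ⊆ W) :
    ∃ n : ℕ, ∀ m : (y.H0 j).vtx U, f j ^ n • m = 0 := by
  obtain ⟨n, hn⟩ := hy.nil _ _ (Finset.erase_subset j (insert j U)) hU j (by simp) rfl
  refine ⟨n, fun m => ?_⟩
  obtain ⟨a, rfl⟩ := pr_surjective y j U m
  obtain ⟨c, hc⟩ := hn a
  rw [← map_smul, ← hc]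
  exact (pr_exact y j U).apply_apply_eq_zero c

lemma Good.regH0 {f : ι → A} {y : Cube (ModuleCat.{u} A) ι} {W : Finset ι}
    (hy : Good f y W) {j : ι} {U : Finset ι} (hU : insert j U ⊆ W)
    (l : List ι) (hl : l.Nodup) (hlW : l.toFinset ⊆ W.erase j) :
    IsWeaklyRegular ((y.H0 j).vtx U) (l.map f) := by
  obtain ⟨n, hn⟩ := hy.killed hU
  have hj : j ∈ W := hU (Finset.mem_insert_self _ _)
  refine isWeaklyRegular_coker (f j) n (l.map f)
    (y.mapLE (Finset.erase_subset j (insert j U))).hom (pr y j U).hom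
    (hy.inj _ _ _ hU j (by simp) rfl) (pr_exact y j U) (pr_surjective y j U) hn ?_
    (hy.reg _ ((Finset.erase_subset _ _).trans hU) l hl (hlW.trans (Finset.erase_subset _ _)))
  intro gs' hgs'
  obtain ⟨l', hl', rfl⟩ := List.prefix_map_iff.1 hgs'
  have hsub : ∀ a ∈ l', a ∈ W ∧ a ≠ j := by
    intro a ha
    have := hlW (List.mem_toFinset.2 (hl'.subset ha))
    rw [Finset.mem_erase] at this
    exact ⟨this.2, this.1⟩
  have := hy.reg _ hU (l' ++ [j]) ?_ ?_
  · simpa using this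
  · rw [List.nodup_append']
    refine ⟨hl.sublist hl'.sublist, by simp, ?_⟩
    intro a ha hb
    simp at hb
    exact (hsub a ha).2 hb
  · intro a ha
    rw [List.mem_toFinset, List.mem_append, List.mem_singleton] at ha
    rcases ha with ha | ha
    · exact (hsub a ha).1
    · exact ha ▸ hj

lemma insert_sub {j : ι} {U W : Finset ι} (hj : j ∈ W) (hU : U ⊆ W.erase j) : insert j U ⊆ W :=
  Finset.insert_subset hj (hU.trans (Finset.erase_subset _ _))

lemma Good.H0 {f : ι → A} {y : Cube (ModuleCat.{u} A) ι} {W : Finset ι}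
    (hy : Good f y W) {j : ι} (hj : j ∈ W) : Good f (y.H0 j) (W.erase j) where
  reg U hU l hl hlW := hy.regH0 (insert_sub hj hU) l hl hlW
  nil U V h hU k hk hV := by
    have hkj : k ≠ j := (Finset.mem_erase.1 (hU hk)).1
    have hUW := insert_sub hj hU
    have h' : (insert j V).erase j ⊆ (insert j U).erase j :=
      Finset.erase_subset_erase _ (Finset.insert_subset_insert _ h)
    obtain ⟨n, hn⟩ := hy.nil ((insert j U).erase j) ((insert j V).erase j) h'
      ((Finset.erase_subset _ _).trans hUW) k (by simp [hk, hkj]) (by subst hV; grind)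
    refine ⟨n, fun m => ?_⟩
    obtain ⟨a, rfl⟩ := pr_surjective y j V m
    obtain ⟨c, hc⟩ := hn a
    refine ⟨(pr y j U).hom c, ?_⟩
    rw [pr_nat y j h h', hc, map_smul]
  inj U V h hU k hk hV := by
    have hkj : k ≠ j := (Finset.mem_erase.1 (hU hk)).1
    have hUW := insert_sub hj hU
    have h1 : insert j V ⊆ insert j U := Finset.insert_subset_insert _ h
    have h' : (insert j V).erase j ⊆ (insert j U).erase j :=
      Finset.erase_subset_erase _ h1
    have hk0 : k ∈ (insert j U).erase j := by simp [hk, hkj]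
    have hV0 : (insert j V).erase j = ((insert j U).erase j).erase k := by subst hV; grind
    have hU0 : (insert j U).erase j ⊆ W := (Finset.erase_subset _ _).trans hUW
    obtain ⟨n, hn⟩ := hy.nil (insert j U) (insert j V) h1 hUW k (by simp [hk])
      (by subst hV; grind)
    have hreg := hy.regH0 hUW [k] (by simp) (by simpa using hU hk)
    simp only [List.map_cons, List.map_nil, isWeaklyRegular_singleton_iff] at hreg
    rw [injective_iff_map_eq_zero]
    intro z hz
    obtain ⟨a, rfl⟩ := pr_surjective y j U z
    rw [pr_nat y j h h'] at hz
    obtain ⟨b, hb⟩ := (pr_exact y j V _).1 hz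
    obtain ⟨c, hc⟩ := hn b
    have key : f k ^ n • a = (y.mapLE (Finset.erase_subset j (insert j U))).hom c := by
      apply hy.inj _ _ h' hU0 k hk0 hV0
      rw [map_smul, ← hb, ← map_smul, ← hc,
        mapLE_mapLE y _ _ (h'.trans (Finset.erase_subset _ _)),
        mapLE_mapLE y _ _ (h'.trans (Finset.erase_subset _ _))]
    have hreg' := hreg.pow n
    apply hreg'
    simp only [smul_zero]
    rw [← map_smul, key]
    exact (pr_exact y j U).apply_apply_eq_zero c

lemma Good.admissible {f : ι → A} (n : ℕ) : ∀ {y : Cube (ModuleCat.{u} A) ι} {W : Finset ι}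
    (_ : W.card = n) (_ : Good f y W), y.Admissible W := by
  induction n with
  | zero =>
    intro y W hW hy
    rw [Finset.card_eq_zero] at hW
    subst hW
    rw [Cube.Admissible]
    refine ⟨?_, ?_⟩
    · intro T hT k hk
      exact absurd (hT hk) (by simp)
    · intro k hk
      simp at hk
  | succ n ih =>
    intro y W hW hy
    rw [Cube.Admissible]
    refine ⟨?_, ?_⟩
    · intro T hT k hk
      exact (mono_iff_inj _).2 (hy.inj T _ _ hT k hk rfl)
    · intro k hk
      exact ih (by rw [Finset.card_erase_of_mem hk, hW]; rfl) (hy.H0 hk)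

lemma good_H0s {f : ι → A} {x : Cube (ModuleCat.{u} A) ι} {S : Finset ι}
    (hx : Good f x S)
    (hfgproj : ∀ T ⊆ S, Module.Finite A (x.vtx T) ∧ Module.Projective A (x.vtx T))
    (l : List ι) (hl : l.Nodup) (hlS : l.toFinset ⊆ S) :
    Good f (x.H0s l) (S \ l.toFinset) ∧ ∀ U ⊆ S \ l.toFinset,
      Module.Finite A ((x.H0s l).vtx U) ∧
      pdLE A l.length ((x.H0s l).vtx U) ∧
      ∀ t ∈ l, ∃ n : ℕ, ∀ m : (x.H0s l).vtx U, (f t) ^ n • m = 0 := by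
  induction l with
  | nil =>
    simp only [List.toFinset_nil, Finset.sdiff_empty]
    exact ⟨hx, fun U hU => ⟨(hfgproj U hU).1, (hfgproj U hU).2,
      fun t ht => absurd ht List.not_mem_nil⟩⟩
  | cons j l ih =>
    rw [List.nodup_cons] at hl
    rw [List.toFinset_cons, Finset.insert_subset_iff] at hlS
    obtain ⟨hg, hU⟩ := ih hl.2 hlS.2
    have hjW : j ∈ S \ l.toFinset := by simp [hlS.1, hl.1]
    have hW : S \ (j :: l).toFinset = (S \ l.toFinset).erase j := by
      ext a; simp; tauto
    rw [hW]
    refine ⟨hg.H0 hjW, fun U hUW => ?_⟩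
    have h1 := insert_sub hjW hUW
    have h0 := (Finset.erase_subset j (insert j U)).trans h1
    obtain ⟨a1, b1, c1⟩ := hU _ h1
    obtain ⟨a0, b0, c0⟩ := hU _ h0
    refine ⟨Module.Finite.of_surjective _ (pr_surjective (x.H0s l) j U), ?_, ?_⟩
    · exact pdLE_of_exact _ _ (hg.inj _ _ _ h1 j (by simp) rfl) (pr_exact (x.H0s l) j U)
        (pr_surjective (x.H0s l) j U) b1 b0
    · intro t ht
      rcases List.mem_cons.1 ht with rfl | ht
      · exact hg.killed h1
      · obtain ⟨n, hn⟩ := c0 t ht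
        refine ⟨n, fun m => ?_⟩
        obtain ⟨a, rfl⟩ := pr_surjective (x.H0s l) j U m
        exact ((pr (x.H0s l) j U).hom.map_smul _ _).symm.trans 
          ((congrArg _ (hn a)).trans (map_zero _))

lemma good_of_koszul {f : ι → A} {x : Cube (ModuleCat.{u} A) ι} {S : Finset ι}
    (hf : IsFamilyASeq S f) (hx : IsKoszulCube x S f) : Good f x S where
  inj U V h hU k hk hV := by
    subst hV
    exact (hx.2 U hU k hk).1
  nil U V h hU k hk hV := by
    subst hV
    obtain ⟨n, hn⟩ := (hx.2 U hU k hk).2.2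
    refine ⟨n, fun m => ?_⟩
    have := hn (Submodule.Quotient.mk m)
    rw [← Submodule.Quotient.mk_smul, Submodule.Quotient.mk_eq_zero] at this
    exact this
  reg U hU l hl hlS := by
    have := (hx.1 U hU).2
    exact isWeaklyRegular_of_flat (isWeaklyRegular_of_family hf l hl hlS) _

end CubeAux

end KoszulAux

/-- Let `A` be a commutative noetherian ring, `S` a finite set and
`{f s}_{s ∈ S}` an `A`-sequence.  An `S`-cube `x` of finitely generated projective
`A`-modules is a Koszul cube associated with `{f s}_{s ∈ S}` if and only if `x` is
admissible and, for every `T ⊆ S` and every `U ⊆ S ∖ T`, the vertex `H⁰_T(x)_U` of the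
iterated cokernel cube (computed via any enumeration of `T`) is a finitely generated
`A`-module of projective dimension at most `#T`, each `f t` (`t ∈ T`) acting nilpotently on
it (i.e. its support is contained in `V(f_T)`). -/
theorem koszul_cube_iff_admissible_and_pure_weight {A : Type u} [CommRing A]
    [IsNoetherianRing A] {ι : Type w} [DecidableEq ι] (S : Finset ι) (f : ι → A)
    (hf : IsFamilyASeq S f) (x : Cube (ModuleCat.{u} A) ι)
    (hfgproj : ∀ T ⊆ S, Module.Finite A (x.vtx T) ∧ Module.Projective A (x.vtx T)) :
    IsKoszulCube x S f ↔
      (x.Admissible S ∧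
        ∀ T ⊆ S, ∀ U ⊆ S \ T, ∀ l : List ι, l.Nodup → l.toFinset = T →
          Module.Finite A ((x.H0s l).vtx U) ∧
          pdLE A T.card ((x.H0s l).vtx U) ∧
          ∀ t ∈ T, ∃ n : ℕ, ∀ m : (x.H0s l).vtx U, (f t) ^ n • m = 0) := by
  open KoszulAux in
  constructor
  · intro hx
    have hg := good_of_koszul hf hx
    refine ⟨hg.admissible _ rfl, ?_⟩
    rintro T hT U hU l hl rfl
    obtain ⟨a, b, c⟩ := (good_H0s hg hfgproj l hl hT).2 U hU
    rw [List.toFinset_card_of_nodup hl]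
    exact ⟨a, b, fun t ht => c t (List.mem_toFinset.1 ht)⟩
  · rintro ⟨hadm, h⟩
    rw [Cube.Admissible] at hadm
    refine ⟨hfgproj, fun T hT k hk => ?_⟩
    have hinj : Function.Injective (x.bd T k).hom := (mono_iff_inj _).1 (hadm.1 T hT k hk)
    refine ⟨hinj, ?_, ?_⟩
    · exact pdLE_of_exact (n := 0) (x.bd T k).hom (LinearMap.range (x.bd T k).hom).mkQ hinj
        (LinearMap.exact_map_mkQ_range _) (Submodule.mkQ_surjective _)
        (hfgproj T hT).2 (hfgproj _ ((Finset.erase_subset _ _).trans hT)).2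
    · have hTk : insert k (T.erase k) = T := Finset.insert_erase hk
      obtain ⟨n, hn⟩ := (h {k} (by simpa using hT hk) (T.erase k) (by
        intro a ha
        rw [Finset.mem_erase] at ha
        simp [hT ha.2, ha.1]) [k] (by simp) (by simp)).2.2 k (by simp)
      refine ⟨n, fun m => ?_⟩
      have key : ∀ T' : Finset ι, T' = T →
          (∀ a : x.vtx (T'.erase k), f k ^ n • a ∈ LinearMap.range (x.bd T' k).hom) →
          ∀ a : x.vtx (T.erase k), f k ^ n • a ∈ LinearMap.range (x.bd T k).hom := by
        rintro T' rfl h; exact h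
      have key2 := key _ hTk (fun a => by
        have e := hn ((pr x k (T.erase k)).hom a)
        have e2 : (pr x k (T.erase k)).hom (f k ^ n • a) = 0 :=
          ((pr x k (T.erase k)).hom.map_smul _ _).trans e
        exact (pr_exact x k (T.erase k) _).1 e2)
      obtain ⟨a, rfl⟩ := Submodule.Quotient.mk_surjective _ m
      rw [← Submodule.Quotient.mk_smul, Submodule.Quotient.mk_eq_zero]
      exact key2 a
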